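/- Let 1 ≤ M ≤ N be integers and set ξ_1(N,M,m) = Σ_{i=m}^{M−1} ((M−i)/M) binom(N,i) binom(i,m) (−1)^{i−m} for 0 ≤ m ≤ M−1. Let μ ∈ ℝ and let F : ℝ → ℝ be differentiable with derivative f, suppose 0 ≤ F(x) < 1 for all x < μ, F(x) → 1 as x → μ from the left, f(x) > 0 for all x in some left neighborhood of μ, and lim_{x→μ⁻} (μ−x) f(x)/(1 − F(x)) = φ for some φ > 0. Define F_Y(x) = Σ_{m=0}^{M−1} ξ_1(N,M,m) F(x)^{N−m} and f_Y(x) = Σ_{m=0}^{M−1} ξ_1(N,M,m)(N−m) F(x)^{N−m−1} f(x). Then lim_{x→μ⁻} (μ−x) f_Y(x)/(1 − F_Y(x)) = φ. -/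

import Mathlib

open Filter Finset

/-- The best-M feedback coefficient ξ₁(N, M, m). -/
noncomputable def xi1 (N M m : ℕ) : ℝ :=
  ∑ i ∈ Finset.Icc m (M - 1),
    (((M : ℝ) - i) / M) * (N.choose i) * (i.choose m) * (-1 : ℝ) ^ (i - m)

/-- The best-M transform, as a polynomial in the value of the distribution function, written as a
weighted binomial sum. -/
theorem sum_xi1_mul_pow {N M : ℕ} (hMN : M ≤ N) (t : ℝ) :
    ∑ m ∈ range M, xi1 N M m * t ^ (N - m) =
      ∑ i ∈ range (M + 1), ((M : ℝ) - i) / M * N.choose i * (t ^ (N - i) * (1 - t) ^ i) := by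
  rw [sum_range_succ, sub_self, zero_div, zero_mul, zero_mul, add_zero]
  simp only [xi1, sum_mul]
  rw [sum_comm' (t' := range M) (s' := fun i => range (i + 1))
    (by intro m i; simp only [mem_range, mem_Icc]; omega)]
  refine sum_congr rfl fun i hi => ?_
  have hi : i < M := mem_range.mp hi
  have hpow : (1 - t) ^ i = (1 + -t) ^ i := by ring
  rw [hpow, add_pow, mul_sum, mul_sum]
  refine sum_congr rfl fun m hm => ?_
  have hm : m ≤ i := Nat.lt_succ_iff.mp (mem_range.mp hm)
  rw [one_pow, one_mul, neg_pow t, show N - m = (N - i) + (i - m) by omega, pow_add]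
  ring

theorem sum_xi1_eq_one {N M : ℕ} (hM : 1 ≤ M) (hMN : M ≤ N) :
    ∑ m ∈ range M, xi1 N M m * (1 : ℝ) ^ (N - m) = 1 := by
  have hM0 : (M : ℝ) ≠ 0 := by positivity
  rw [sum_xi1_mul_pow hMN, sum_range_succ']
  simp [hM0]

theorem hasDerivAt_sum_xi1 {N M : ℕ} (hMN : M ≤ N) (t : ℝ) :
    HasDerivAt (fun t : ℝ => ∑ m ∈ range M, xi1 N M m * t ^ (N - m))
      (∑ m ∈ range M, xi1 N M m * (N - m : ℝ) * t ^ (N - m - 1)) t := by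
  refine HasDerivAt.fun_sum fun m hm => ?_
  have hm : m ≤ N := (mem_range.mp hm).le.trans hMN
  have h := (hasDerivAt_pow (N - m) t).const_mul (xi1 N M m)
  rwa [Nat.cast_sub hm, ← mul_assoc] at h

theorem sum_xi1_deriv_one {N M : ℕ} (hM : 1 ≤ M) (hMN : M ≤ N) :
    ∑ m ∈ range M, xi1 N M m * (N - m : ℝ) * (1 : ℝ) ^ (N - m - 1) = N / M := by
  have hM0 : (M : ℝ) ≠ 0 := by positivity
  have h := hasDerivAt_sum_xi1 hMN 1
  simp only [sum_xi1_mul_pow hMN] at h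
  have h' : HasDerivAt
      (fun t : ℝ =>
        ∑ i ∈ range (M + 1), ((M : ℝ) - i) / M * N.choose i * (t ^ (N - i) * (1 - t) ^ i))
      (∑ i ∈ range (M + 1), ((M : ℝ) - i) / M * N.choose i *
        (((N - i : ℕ) : ℝ) * 1 ^ (N - i - 1) * (1 - 1) ^ i +
          1 ^ (N - i) * (i * (1 - 1) ^ (i - 1) * (-1)))) 1 :=
    HasDerivAt.fun_sum fun i _ =>
      ((hasDerivAt_pow (N - i) 1).mul (((hasDerivAt_id (1 : ℝ)).const_sub 1).pow i)).const_mul _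
  rw [h.unique h']
  obtain ⟨k, rfl⟩ := Nat.exists_eq_add_of_le' hM
  rw [sum_range_succ', sum_range_succ']
  simp only [Nat.cast_add, Nat.cast_one] at hM0
  simp
  field_simp
  ring

theorem bestM_preserves_weibull_condition (N M : ℕ) (hM : 1 ≤ M) (hMN : M ≤ N)
    (μ : ℝ) (F f : ℝ → ℝ) (hderiv : ∀ x, HasDerivAt F (f x) x)
    (hF01 : ∀ x < μ, 0 ≤ F x ∧ F x < 1)
    (hFlim : Tendsto F (nhdsWithin μ (Set.Iio μ)) (nhds 1))
    (hfpos : ∀ᶠ x in nhdsWithin μ (Set.Iio μ), 0 < f x)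
    (φ : ℝ) (hφ : 0 < φ)
    (hvonMises : Tendsto (fun x => (μ - x) * f x / (1 - F x))
      (nhdsWithin μ (Set.Iio μ)) (nhds φ))
    (FY fY : ℝ → ℝ)
    (hFY : ∀ x, FY x = ∑ m ∈ Finset.range M, xi1 N M m * (F x) ^ (N - m))
    (hfY : ∀ x, fY x = ∑ m ∈ Finset.range M, xi1 N M m * (N - m : ℝ) * (F x) ^ (N - m - 1) * f x) :
    Tendsto (fun x => (μ - x) * fY x / (1 - FY x))
      (nhdsWithin μ (Set.Iio μ)) (nhds φ) := by
  set P : ℝ → ℝ := fun t => ∑ m ∈ range M, xi1 N M m * t ^ (N - m)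
  set P' : ℝ → ℝ := fun t => ∑ m ∈ range M, xi1 N M m * (N - m : ℝ) * t ^ (N - m - 1)
  have hP1 : P 1 = 1 := sum_xi1_eq_one hM hMN
  have hP'1 : P' 1 ≠ 0 := by
    have hM0 : (M : ℝ) ≠ 0 := by positivity
    have hN0 : (N : ℝ) ≠ 0 := by exact_mod_cast (by omega : N ≠ 0)
    rw [show P' 1 = N / M from sum_xi1_deriv_one hM hMN]
    exact div_ne_zero hN0 hM0
  have hlt : ∀ᶠ x in nhdsWithin μ (Set.Iio μ), F x < 1 :=
    eventually_nhdsWithin_of_forall fun x hx => (hF01 x hx).2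
  have hslope : Tendsto (fun x => slope P 1 (F x)) (nhdsWithin μ (Set.Iio μ)) (nhds (P' 1)) :=
    (hasDerivAt_iff_tendsto_slope.mp (hasDerivAt_sum_xi1 hMN 1)).comp
      (tendsto_nhdsWithin_iff.mpr ⟨hFlim, hlt.mono fun x hx => hx.ne⟩)
  have hcont : Continuous P' := by fun_prop
  have hlim := hvonMises.mul (((hcont.tendsto 1).comp hFlim).div hslope hP'1)
  rw [div_self hP'1, mul_one] at hlim
  refine hlim.congr' ?_
  filter_upwards [hlt] with x hx
  have hfYx : fY x = P' (F x) * f x := by rw [hfY, ← sum_mul]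
  have hFYx : FY x = P (F x) := hFY x
  have hne : 1 - F x ≠ 0 := (sub_pos.mpr hx).ne'
  have hsl : slope P 1 (F x) = (1 - P (F x)) / (1 - F x) := by
    rw [slope_comm, slope_def_field, hP1]
  simp only [Function.comp_apply, Pi.div_apply]
  rw [hfYx, hFYx, hsl]
  field_simp
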